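/- Let a₁, a₂ ∈ ℝ, let 0 < α₁ < α₂, let κ₁ ≥ 0 and κ₂ > 0. Then there exists a C^∞ function Φ : ℝ² → ℝ such that (1) Φ(z) → ∞ as |z| → ∞, and (2) there exist positive constants C and D with (LΦ)(z) ≤ −C·Φ(z) + D for all z ∈ ℝ². -/

import Mathlib

noncomputable def Lop (a₁ a₂ α₁ α₂ κ₁ κ₂ : ℝ) (Φ : ℝ × ℝ → ℝ) (p : ℝ × ℝ) : ℝ :=
  (a₁ * p.1 - α₁ * p.1 ^ 2 + p.2 ^ 2) * deriv (fun t => Φ (t, p.2)) p.1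
    + (a₂ * p.2 - α₂ * p.1 * p.2) * deriv (fun t => Φ (p.1, t)) p.2
    + κ₁ * deriv (deriv (fun t => Φ (t, p.2))) p.1
    + κ₂ * deriv (deriv (fun t => Φ (p.1, t))) p.2

/-- `φ` is a Lyapunov function for the operator `L` (with the given parameters) on `U`:
(I) `φ` is `C^∞` on `U`; (II) `φ z → ∞` as `|z| → ∞`, `z ∈ U`;
(III) there are `C, D > 0` with `Lφ ≤ -C•φ + D` on `U`. -/
def IsLyapunovOn (a₁ a₂ α₁ α₂ κ₁ κ₂ : ℝ) (φ : ℝ × ℝ → ℝ) (U : Set (ℝ × ℝ)) : Prop :=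
  ContDiffOn ℝ (⊤ : ℕ∞) φ U ∧
    (∀ M : ℝ, ∃ R : ℝ, ∀ z ∈ U, R < ‖z‖ → M < φ z) ∧
    (∃ C > (0:ℝ), ∃ D > (0:ℝ), ∀ z ∈ U, Lop a₁ a₂ α₁ α₂ κ₁ κ₂ φ z ≤ -C * φ z + D)

noncomputable def Rf (g x y : ℝ) : ℝ := Real.sqrt (x ^ 2 + g * y ^ 2)
noncomputable def Vf (g x y : ℝ) : ℝ := Rf g x y ^ 3 + x * Rf g x y ^ 2
noncomputable def FF (k v : ℝ) : ℝ := Real.log (v + k) - 8 * k / (v + k)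
noncomputable def F1 (k v : ℝ) : ℝ := (v + 9 * k) / (v + k) ^ 2
noncomputable def F2 (k v : ℝ) : ℝ := -(v + 17 * k) / (v + k) ^ 3
noncomputable def Ph (g k c x y : ℝ) : ℝ := (2 + c) * Real.log (Rf g x y) - c * FF k (Vf g x y)
noncomputable def Ax (g x y : ℝ) : ℝ := 3 * Rf g x y * x + Rf g x y ^ 2 + 2 * x ^ 2
noncomputable def Ay (g x y : ℝ) : ℝ := (3 * Rf g x y + 2 * x) * (g * y)
noncomputable def Px (g k c x y : ℝ) : ℝ :=
  (2 + c) * (x / Rf g x y ^ 2) - c * (F1 k (Vf g x y) * Ax g x y)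
noncomputable def Py (g k c x y : ℝ) : ℝ :=
  (2 + c) * (g * y / Rf g x y ^ 2) - c * (F1 k (Vf g x y) * Ay g x y)
noncomputable def Pxx (g k c x y : ℝ) : ℝ :=
  (2 + c) * ((Rf g x y ^ 2 - 2 * x ^ 2) / Rf g x y ^ 4)
    - c * (F2 k (Vf g x y) * Ax g x y ^ 2
      + F1 k (Vf g x y) * (3 * Rf g x y + 3 * x ^ 2 / Rf g x y + 6 * x))
noncomputable def Pyy (g k c x y : ℝ) : ℝ :=
  (2 + c) * ((g * Rf g x y ^ 2 - 2 * g ^ 2 * y ^ 2) / Rf g x y ^ 4)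
    - c * (F2 k (Vf g x y) * Ay g x y ^ 2
      + F1 k (Vf g x y) * (g * (3 * Rf g x y + 2 * x) + 3 * g ^ 2 * y ^ 2 / Rf g x y))

lemma Rf_pos {g x y : ℝ} (h : 0 < x ^ 2 + g * y ^ 2) : 0 < Rf g x y := Real.sqrt_pos.2 h

lemma Rf_sq {g x y : ℝ} (h : 0 < x ^ 2 + g * y ^ 2) : Rf g x y ^ 2 = x ^ 2 + g * y ^ 2 :=
  Real.sq_sqrt h.le

lemma abs_le_Rf {g x y : ℝ} (hg : 0 < g) : |x| ≤ Rf g x y := by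
  apply Real.abs_le_sqrt
  nlinarith [mul_nonneg hg.le (sq_nonneg y)]

lemma Vf_nonneg {g x y : ℝ} (hg : 0 < g) : 0 ≤ Vf g x y := by
  have h := (abs_le.1 (abs_le_Rf (x := x) (y := y) hg)).1
  have : Vf g x y = Rf g x y ^ 2 * (Rf g x y + x) := by unfold Vf; ring
  rw [this]
  exact mul_nonneg (sq_nonneg _) (by linarith)

lemma hR_x {g x y : ℝ} (h : 0 < x ^ 2 + g * y ^ 2) :
    HasDerivAt (fun t => Rf g t y) (x / Rf g x y) x := by
  have h1 : HasDerivAt (fun t : ℝ => t ^ 2 + g * y ^ 2) (2 * x) x := by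
    simpa using (hasDerivAt_pow 2 x).add_const (g * y ^ 2)
  have h2 := h1.sqrt h.ne'
  have h0 := Rf_pos h
  refine HasDerivAt.congr_deriv h2 ?_
  symm
  change x / Rf g x y = 2 * x / (2 * Rf g x y)
  field_simp

lemma hR_y {g x y : ℝ} (h : 0 < x ^ 2 + g * y ^ 2) :
    HasDerivAt (fun t => Rf g x t) (g * y / Rf g x y) y := by
  have h1 : HasDerivAt (fun t : ℝ => x ^ 2 + g * t ^ 2) (g * (2 * y)) y := by
    simpa using ((hasDerivAt_pow 2 y).const_mul g).const_add (x ^ 2)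
  have h2 := h1.sqrt h.ne'
  have h0 := Rf_pos h
  refine HasDerivAt.congr_deriv h2 ?_
  symm
  change g * y / Rf g x y = g * (2 * y) / (2 * Rf g x y)
  field_simp

lemma hV_x {g x y : ℝ} (h : 0 < x ^ 2 + g * y ^ 2) :
    HasDerivAt (fun t => Vf g t y) (Ax g x y) x := by
  have h1 := hR_x h
  have h0 := Rf_pos h
  refine HasDerivAt.congr_deriv ((h1.fun_pow 3).fun_add ((hasDerivAt_id' x).fun_mul (h1.fun_pow 2))) ?_
  symm
  simp only [Ax]
  push_cast
  field_simp
  ring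

lemma hV_y {g x y : ℝ} (h : 0 < x ^ 2 + g * y ^ 2) :
    HasDerivAt (fun t => Vf g x t) (Ay g x y) y := by
  have h1 := hR_y h
  have h0 := Rf_pos h
  refine HasDerivAt.congr_deriv ((h1.fun_pow 3).fun_add ((h1.fun_pow 2).const_mul x)) ?_
  symm
  simp only [Ay]
  push_cast
  field_simp

lemma hA_x {g x y : ℝ} (h : 0 < x ^ 2 + g * y ^ 2) :
    HasDerivAt (fun t => Ax g t y) (3 * Rf g x y + 3 * x ^ 2 / Rf g x y + 6 * x) x := by
  have h1 := hR_x h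
  have h0 := Rf_pos h
  refine HasDerivAt.congr_deriv ((((h1.const_mul 3).fun_mul (hasDerivAt_id' x)).fun_add (h1.fun_pow 2)).fun_add
    ((hasDerivAt_pow 2 x).const_mul 2)) ?_
  symm
  push_cast
  field_simp
  ring

lemma hA_y {g x y : ℝ} (h : 0 < x ^ 2 + g * y ^ 2) :
    HasDerivAt (fun t => Ay g x t)
      (g * (3 * Rf g x y + 2 * x) + 3 * g ^ 2 * y ^ 2 / Rf g x y) y := by
  have h1 := hR_y h
  have h0 := Rf_pos h
  refine HasDerivAt.congr_deriv (((h1.const_mul 3).add_const (2 * x)).fun_mul ((hasDerivAt_id' y).const_mul g)) ?_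
  symm
  field_simp
  ring

lemma hFF {k v : ℝ} (h : 0 < v + k) : HasDerivAt (FF k) (F1 k v) v := by
  have h1 : HasDerivAt (fun t : ℝ => t + k) 1 v := (hasDerivAt_id' v).add_const k
  refine HasDerivAt.congr_deriv ((h1.log h.ne').fun_sub ((hasDerivAt_const v (8 * k)).fun_div h1 h.ne')) ?_
  symm
  simp only [F1]
  field_simp
  ring

lemma hF1 {k v : ℝ} (h : 0 < v + k) : HasDerivAt (F1 k) (F2 k v) v := by
  have h1 : HasDerivAt (fun t : ℝ => t + k) 1 v := (hasDerivAt_id' v).add_const k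
  have h2 : HasDerivAt (fun t : ℝ => t + 9 * k) 1 v := (hasDerivAt_id' v).add_const _
  refine HasDerivAt.congr_deriv (h2.fun_div (h1.fun_pow 2) (pow_pos h 2).ne') ?_
  symm
  simp only [F2]
  push_cast
  field_simp
  ring

lemma hP_x {g k x y : ℝ} (c : ℝ) (hg : 0 < g) (hk : 0 < k) (h : 0 < x ^ 2 + g * y ^ 2) :
    HasDerivAt (fun t => Ph g k c t y) (Px g k c x y) x := by
  have h0 := Rf_pos h
  have hv : 0 < Vf g x y + k := by linarith [Vf_nonneg (x := x) (y := y) hg]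
  have e : HasDerivAt (fun t => FF k (Vf g t y)) (F1 k (Vf g x y) * Ax g x y) x :=
    HasDerivAt.comp (h₂ := FF k) x (hFF hv) (hV_x h)
  refine HasDerivAt.congr_deriv ((((hR_x h).log h0.ne').const_mul (2 + c)).fun_sub
    (e.const_mul c)) ?_
  symm
  simp only [Px]
  field_simp

lemma hP_y {g k x y : ℝ} (c : ℝ) (hg : 0 < g) (hk : 0 < k) (h : 0 < x ^ 2 + g * y ^ 2) :
    HasDerivAt (fun t => Ph g k c x t) (Py g k c x y) y := by
  have h0 := Rf_pos h
  have hv : 0 < Vf g x y + k := by linarith [Vf_nonneg (x := x) (y := y) hg]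
  have e : HasDerivAt (fun t => FF k (Vf g x t)) (F1 k (Vf g x y) * Ay g x y) y :=
    HasDerivAt.comp (h₂ := FF k) y (hFF hv) (hV_y h)
  refine HasDerivAt.congr_deriv ((((hR_y h).log h0.ne').const_mul (2 + c)).fun_sub
    (e.const_mul c)) ?_
  symm
  simp only [Py]
  field_simp

lemma hP_xx {g k x y : ℝ} (c : ℝ) (hg : 0 < g) (hk : 0 < k) (h : 0 < x ^ 2 + g * y ^ 2) :
    HasDerivAt (fun t => Px g k c t y) (Pxx g k c x y) x := by
  have h0 := Rf_pos h
  have hv : 0 < Vf g x y + k := by linarith [Vf_nonneg (x := x) (y := y) hg]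
  have e : HasDerivAt (fun t => F1 k (Vf g t y)) (F2 k (Vf g x y) * Ax g x y) x :=
    HasDerivAt.comp (h₂ := F1 k) x (hF1 hv) (hV_x h)
  refine HasDerivAt.congr_deriv ((((hasDerivAt_id' x).fun_div ((hR_x h).fun_pow 2) (pow_pos h0 2).ne').const_mul
    (2 + c)).fun_sub
    ((e.fun_mul (hA_x h)).const_mul c)) ?_
  symm
  simp only [Pxx]
  push_cast
  field_simp

lemma hP_yy {g k x y : ℝ} (c : ℝ) (hg : 0 < g) (hk : 0 < k) (h : 0 < x ^ 2 + g * y ^ 2) :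
    HasDerivAt (fun t => Py g k c x t) (Pyy g k c x y) y := by
  have h0 := Rf_pos h
  have hv : 0 < Vf g x y + k := by linarith [Vf_nonneg (x := x) (y := y) hg]
  have e : HasDerivAt (fun t => F1 k (Vf g x t)) (F2 k (Vf g x y) * Ay g x y) y :=
    HasDerivAt.comp (h₂ := F1 k) y (hF1 hv) (hV_y h)
  refine HasDerivAt.congr_deriv (((((hasDerivAt_id' y).const_mul g).fun_div ((hR_y h).fun_pow 2)
    (pow_pos h0 2).ne').const_mul (2 + c)).fun_sub
    ((e.fun_mul (hA_y h)).const_mul c)) ?_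
  symm
  simp only [Pyy]
  push_cast
  field_simp

lemma core_eq (a₁ a₂ α₁ d κ₁ κ₂ c R u y P Q : ℝ) (hd : 0 < d) (hR : 0 < R)
    (hy : y ^ 2 = d * (R ^ 2 * (1 - u ^ 2))) :
    (a₁ * (R * u) - α₁ * (R * u) ^ 2 + y ^ 2) *
        ((2 + c) * (R * u / R ^ 2) - c * (P * (3 * R * (R * u) + R ^ 2 + 2 * (R * u) ^ 2)))
      + (a₂ * y - (α₁ + d) * (R * u) * y) *
        ((2 + c) * (d⁻¹ * y / R ^ 2) - c * (P * ((3 * R + 2 * (R * u)) * (d⁻¹ * y))))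
      + κ₁ * ((2 + c) * ((R ^ 2 - 2 * (R * u) ^ 2) / R ^ 4)
        - c * (Q * (3 * R * (R * u) + R ^ 2 + 2 * (R * u) ^ 2) ^ 2
          + P * (3 * R + 3 * (R * u) ^ 2 / R + 6 * (R * u))))
      + κ₂ * ((2 + c) * ((d⁻¹ * R ^ 2 - 2 * d⁻¹ ^ 2 * y ^ 2) / R ^ 4)
        - c * (Q * ((3 * R + 2 * (R * u)) * (d⁻¹ * y)) ^ 2
          + P * (d⁻¹ * (3 * R + 2 * (R * u)) + 3 * d⁻¹ ^ 2 * y ^ 2 / R)))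
    = (2 + c) * (-α₁ * u * R + a₁ * u ^ 2 + a₂ * (1 - u ^ 2) + κ₁ * ((1 - 2 * u ^ 2) / R ^ 2)
        + κ₂ * d⁻¹ * ((1 - 2 * (1 - u ^ 2)) / R ^ 2))
      - c * (R * ((R ^ 3 * (1 + u)) * P) * (2 * (α₁ + d) + α₁ - (3 * α₁ + d) * (1 + u))
        + a₁ * (u * (1 + 2 * u) * ((R ^ 3 * (1 + u)) * P))
        + a₂ * ((1 - u) * (3 + 2 * u) * ((R ^ 3 * (1 + u)) * P))
        + κ₁ * ((3 * ((R ^ 3 * (1 + u)) * P) * (1 + u)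
            + (R ^ 3 * (1 + u)) ^ 2 * Q * (1 + 2 * u) ^ 2) / R ^ 2)
        + κ₂ * d⁻¹ * (R * (P * (3 + 2 * u + 3 * (1 - u ^ 2))
            + Q * (R ^ 3 * (1 + u)) * ((1 - u) * (3 + 2 * u) ^ 2)))) := by
  have e : ∀ X Y Z W S T M : ℝ, (X + y ^ 2) * Y + (a₂ * y - (α₁ + d) * (R * u) * y) *
        ((2 + c) * (d⁻¹ * y / R ^ 2) - c * (P * ((3 * R + 2 * (R * u)) * (d⁻¹ * y)))) + Z
      + κ₂ * ((2 + c) * ((d⁻¹ * R ^ 2 - 2 * d⁻¹ ^ 2 * y ^ 2) / R ^ 4)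
        - c * (Q * ((3 * R + 2 * (R * u)) * (d⁻¹ * y)) ^ 2
          + P * (d⁻¹ * (3 * R + 2 * (R * u)) + 3 * d⁻¹ ^ 2 * y ^ 2 / R)))
     = (X + y ^ 2) * Y + y ^ 2 * (a₂ - (α₁ + d) * (R * u)) *
        ((2 + c) * (d⁻¹ / R ^ 2) - c * (P * ((3 * R + 2 * (R * u)) * d⁻¹))) + Z
      + κ₂ * ((2 + c) * ((d⁻¹ * R ^ 2 - 2 * d⁻¹ ^ 2 * y ^ 2) / R ^ 4)
        - c * (Q * ((3 * R + 2 * (R * u)) * d⁻¹) ^ 2 * y ^ 2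
          + P * (d⁻¹ * (3 * R + 2 * (R * u)) + 3 * d⁻¹ ^ 2 * y ^ 2 / R))) := by
    intros; ring
  rw [e _ _ _ 0 0 0 0, hy]
  field_simp
  ring

lemma mul_le_abs_mul {a t M : ℝ} (h : |t| ≤ M) : a * t ≤ |a| * M := by
  calc a * t ≤ |a * t| := le_abs_self _
    _ = |a| * |t| := abs_mul _ _
    _ ≤ _ := by gcongr

lemma pb {k v : ℝ} (hk : 0 < k) (hv : 0 ≤ v) :
    0 ≤ v * F1 k v ∧ v * F1 k v ≤ 9 ∧ 0 ≤ F1 k v ∧ v * (v * F1 k v - 1) ≤ 7 * k ∧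
    v ^ 2 * F2 k v ≤ 0 ∧ -17 ≤ v ^ 2 * F2 k v ∧ F2 k v ≤ 0 ∧
    1 ≤ v * F1 k v + k / 3 * (F1 k v + 2 * v * F2 k v) := by
  have hvk : 0 < v + k := by linarith
  have h1 : 0 ≤ F1 k v := by unfold F1; positivity
  have h2 : F2 k v ≤ 0 := by
    unfold F2; rw [neg_div]; exact neg_nonpos.2 (by positivity)
  refine ⟨mul_nonneg hv h1, ?_, h1, ?_, mul_nonpos_of_nonneg_of_nonpos (sq_nonneg v) h2, ?_, h2, ?_⟩
  · unfold F1
    rw [← mul_div_assoc, div_le_iff₀ (by positivity)]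
    nlinarith [mul_nonneg hv hk.le, sq_nonneg v, sq_nonneg k]
  · have : v * (v * F1 k v - 1) = v * (7 * k * v - k ^ 2) / (v + k) ^ 2 := by
      unfold F1; field_simp; ring
    rw [this, div_le_iff₀ (by positivity)]
    have := mul_nonneg hv (sq_nonneg k)
    have := pow_pos hk 3
    nlinarith
  · have : v ^ 2 * F2 k v = -(v ^ 2 * (v + 17 * k)) / (v + k) ^ 3 := by
      unfold F2; ring
    rw [this, le_div_iff₀ (by positivity)]
    have := mul_nonneg hv (sq_nonneg k)
    have := mul_nonneg (sq_nonneg v) hk.le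
    have := pow_pos hk 3
    have := pow_nonneg hv 3
    nlinarith
  · have : v * F1 k v + k / 3 * (F1 k v + 2 * v * F2 k v) - 1
        = k * (20 / 3 * v ^ 2 - 2 * k * v + 2 * k ^ 2) / (v + k) ^ 3 := by
      unfold F1 F2; field_simp; ring
    have h3 : 0 ≤ k * (20 / 3 * v ^ 2 - 2 * k * v + 2 * k ^ 2) / (v + k) ^ 3 := by
      apply div_nonneg _ (by positivity)
      apply mul_nonneg hk.le
      nlinarith [sq_nonneg (v - k), sq_nonneg v, sq_nonneg k]
    linarith

set_option maxHeartbeats 1000000 in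
/-- the decisive inequality, in polar type coordinates. -/
lemma core_ineq (a₁ a₂ α₁ d κ₁ κ₂ c k : ℝ) (hα : 0 < α₁) (hd : 0 < d) (hκ₁ : 0 ≤ κ₁)
    (hκ₂ : 0 < κ₂) (hc0 : 0 < c) (hc1 : c < 1) (hc : α₁ < c * (α₁ + d))
    (hk : κ₂ * d⁻¹ = (2 * (α₁ + d) + α₁) * (k / 3)) (hk0 : 0 < k) :
    ∃ δ > 0, ∃ B : ℝ, ∀ R u v : ℝ, 1 ≤ R → -1 ≤ u → u ≤ 1 → v = R ^ 3 * (1 + u) →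
    (2 + c) * (-α₁ * u * R + a₁ * u ^ 2 + a₂ * (1 - u ^ 2) + κ₁ * ((1 - 2 * u ^ 2) / R ^ 2)
        + κ₂ * d⁻¹ * ((1 - 2 * (1 - u ^ 2)) / R ^ 2))
      - c * (R * (v * F1 k v) * (2 * (α₁ + d) + α₁ - (3 * α₁ + d) * (1 + u))
        + a₁ * (u * (1 + 2 * u) * (v * F1 k v))
        + a₂ * ((1 - u) * (3 + 2 * u) * (v * F1 k v))
        + κ₁ * ((3 * (v * F1 k v) * (1 + u)
            + v ^ 2 * F2 k v * (1 + 2 * u) ^ 2) / R ^ 2)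
        + κ₂ * d⁻¹ * (R * (F1 k v * (3 + 2 * u + 3 * (1 - u ^ 2))
            + F2 k v * v * ((1 - u) * (3 + 2 * u) ^ 2)))) ≤ -δ * R + B := by
  refine ⟨min (2 * (c * (α₁ + d) - α₁)) ((2 - 2 * c) * α₁),
    lt_min (by linarith) (mul_pos (by linarith) hα),
    (2 + c) * (|a₁| * 1 + |a₂| * 1 + κ₁ * 1 + κ₂ * d⁻¹ * 1)
      + c * (|a₁| * 27 + |a₂| * 90 + κ₁ * 153 + κ₂ * d⁻¹ * 255 + (3 * α₁ + d) * (7 * k)), ?_⟩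
  intro R u v hR hu1 hu2 hv
  set δ := min (2 * (c * (α₁ + d) - α₁)) ((2 - 2 * c) * α₁) with hδ
  have hδ1 : δ ≤ 2 * (c * (α₁ + d) - α₁) := min_le_left _ _
  have hδ2 : δ ≤ (2 - 2 * c) * α₁ := min_le_right _ _
  have hR0 : 0 < R := by linarith
  have hw : 0 ≤ 1 + u := by linarith
  have hv0 : 0 ≤ v := by rw [hv]; positivity
  obtain ⟨p0, p9, f0, pv, q0, q17, g0, ode⟩ := pb hk0 hv0
  have hσ : 0 < κ₂ * d⁻¹ := by positivity
  set σ := κ₂ * d⁻¹ with hσd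
  set P := F1 k v
  set Q := F2 k v
  clear_value P Q σ δ
  have hu : u ^ 2 ≤ 1 := by nlinarith
  have hu0 := sq_nonneg u
  have hR2 : 1 ≤ R ^ 2 := by nlinarith
  have hdiv : ∀ t M : ℝ, 0 ≤ M → t ≤ M → t / R ^ 2 ≤ M := by
    intro t M hM ht
    rw [div_le_iff₀ (by positivity)]
    nlinarith
  have b1 : a₁ * u ^ 2 ≤ |a₁| * 1 := mul_le_abs_mul (abs_le.2 ⟨by linarith, hu⟩)
  have b2 : a₂ * (1 - u ^ 2) ≤ |a₂| * 1 := mul_le_abs_mul (abs_le.2 ⟨by linarith, by linarith⟩)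
  have b3 : κ₁ * ((1 - 2 * u ^ 2) / R ^ 2) ≤ κ₁ * 1 :=
    mul_le_mul_of_nonneg_left (hdiv _ _ zero_le_one (by linarith)) hκ₁
  have b4 : σ * ((1 - 2 * (1 - u ^ 2)) / R ^ 2) ≤ σ * 1 :=
    mul_le_mul_of_nonneg_left (hdiv _ _ zero_le_one (by linarith)) hσ.le
  have b5 : -a₁ * (u * (1 + 2 * u) * (v * P)) ≤ |-a₁| * 27 := by
    apply mul_le_abs_mul
    rw [abs_mul, abs_of_nonneg p0]
    have : |u * (1 + 2 * u)| ≤ 3 := abs_le.2 ⟨by nlinarith, by nlinarith⟩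
    calc _ ≤ 3 * (9 : ℝ) := by gcongr
      _ = 27 := by norm_num
  have b6 : -a₂ * ((1 - u) * (3 + 2 * u) * (v * P)) ≤ |-a₂| * 90 := by
    apply mul_le_abs_mul
    rw [abs_mul, abs_of_nonneg p0]
    have : |(1 - u) * (3 + 2 * u)| ≤ 10 := abs_le.2 ⟨by nlinarith, by nlinarith⟩
    calc _ ≤ 10 * (9 : ℝ) := by gcongr
      _ = 90 := by norm_num
  rw [abs_neg] at b5 b6
  have b7 : κ₁ * (-(3 * (v * P) * (1 + u) + v ^ 2 * Q * (1 + 2 * u) ^ 2) / R ^ 2) ≤ κ₁ * 153 := by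
    apply mul_le_mul_of_nonneg_left (hdiv _ _ (by norm_num) _) hκ₁
    have h1 : 0 ≤ 3 * (v * P) * (1 + u) := by positivity
    have h2 : (1 + 2 * u) ^ 2 ≤ 9 := by nlinarith
    have h3 : -(v ^ 2 * Q) * (1 + 2 * u) ^ 2 ≤ 17 * 9 :=
      mul_le_mul (by linarith) h2 (sq_nonneg _) (by norm_num)
    linarith
  -- the noise term
  have hvR : R * (v * (1 + u)) = v ^ 2 / R ^ 2 := by
    rw [hv]; field_simp
  have b8 : R * (P + 2 * v * Q) - 255 ≤ R * (P * (3 + 2 * u + 3 * (1 - u ^ 2))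
            + Q * v * ((1 - u) * (3 + 2 * u) ^ 2)) := by
    have h1 : P ≤ P * (3 + 2 * u + 3 * (1 - u ^ 2)) := by
      apply le_mul_of_one_le_right f0; linarith
    have h2 : (1 - u) * (3 + 2 * u) ^ 2 ≤ 2 + 15 * (1 + u) := by
      nlinarith [mul_nonneg hw (sub_nonneg.2 hu2), pow_nonneg hw 3]
    have h3 : Q * v * (2 + 15 * (1 + u)) ≤ Q * v * ((1 - u) * (3 + 2 * u) ^ 2) :=
      mul_le_mul_of_nonpos_left h2 (mul_nonpos_of_nonpos_of_nonneg g0 hv0)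
    have h4 : -17 ≤ R * (v * (1 + u)) * Q := by
      rw [hvR]
      have : v ^ 2 / R ^ 2 * Q = - (-(v ^ 2 * Q) / R ^ 2) := by ring
      rw [this]
      linarith [hdiv (-(v ^ 2 * Q)) 17 (by norm_num) (by linarith)]
    have h5 := mul_le_mul_of_nonneg_left (add_le_add h1 h3) hR0.le
    linarith
  have b9 : R * ((1 + u) * (v * P - 1)) ≤ 7 * k := by
    have : R * ((1 + u) * (v * P - 1)) = v * (v * P - 1) / R ^ 2 := by
      have : R * (1 + u) = v / R ^ 2 := by rw [hv]; field_simp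
      rw [← mul_assoc, this]; ring
    rw [this]
    exact hdiv _ _ (by positivity) pv
  -- assemble
  have b8' := mul_le_mul_of_nonneg_left b8 hσ.le
  have b9' := mul_le_mul_of_nonneg_left b9 (by positivity : 0 ≤ 3 * α₁ + d)
  have ode' := mul_le_mul_of_nonneg_left ode (by positivity : 0 ≤ R * (2 * (α₁ + d) + α₁))
  have key : R * (2 * (α₁ + d) + α₁) ≤ R * (v * P) * (2 * (α₁ + d) + α₁)
      + σ * (R * (P + 2 * v * Q)) := by
    rw [hk]; linarith
  have lin : R * ((2 + c) * (-α₁ * u) - c * (2 * (α₁ + d) + α₁) + c * ((3 * α₁ + d) * (1 + u)))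
      ≤ R * (-δ) := by
    apply mul_le_mul_of_nonneg_left _ hR0.le
    have e1 := mul_le_mul_of_nonneg_left hδ1 (by linarith : 0 ≤ (1 - u) / 2)
    have e2 := mul_le_mul_of_nonneg_left hδ2 (by linarith : 0 ≤ (1 + u) / 2)
    linarith
  have s1 := mul_le_mul_of_nonneg_left (add_le_add (add_le_add (add_le_add b1 b2) b3) b4)
    (by linarith : 0 ≤ 2 + c)
  have s2 := mul_le_mul_of_nonneg_left (add_le_add (add_le_add (add_le_add b5 b6) b7)
    (add_le_add (add_le_add b8' b9') key)) hc0.le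
  simp only [div_eq_mul_inv] at s1 s2 ⊢
  generalize (R ^ 2)⁻¹ = ι at s1 s2 ⊢
  linarith only [s1, s2, lin]

lemma slice_x {Φ : ℝ × ℝ → ℝ} (h : Differentiable ℝ Φ) (x y : ℝ) :
    deriv (fun t => Φ (t, y)) x = fderiv ℝ Φ (x, y) (1, 0) := by
  have h1 : HasDerivAt (fun t : ℝ => (t, y)) ((1 : ℝ), (0 : ℝ)) x :=
    (hasDerivAt_id' x).prodMk (hasDerivAt_const x y)
  exact ((h (x, y)).hasFDerivAt.comp_hasDerivAt x h1).deriv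

lemma slice_y {Φ : ℝ × ℝ → ℝ} (h : Differentiable ℝ Φ) (x y : ℝ) :
    deriv (fun t => Φ (x, t)) y = fderiv ℝ Φ (x, y) (0, 1) := by
  have h1 : HasDerivAt (fun t : ℝ => (x, t)) ((0 : ℝ), (1 : ℝ)) y :=
    (hasDerivAt_const y x).prodMk (hasDerivAt_id' y)
  exact ((h (x, y)).hasFDerivAt.comp_hasDerivAt y h1).deriv

lemma contDiff_dir {Φ : ℝ × ℝ → ℝ} (h : ContDiff ℝ (⊤ : ℕ∞) Φ) (e : ℝ × ℝ) :
    ContDiff ℝ (⊤ : ℕ∞) (fun z => fderiv ℝ Φ z e) :=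
  (h.fderiv_right (m := (⊤ : ℕ∞)) (by simp)).clm_apply contDiff_const

lemma Lop_cont (a₁ a₂ α₁ α₂ κ₁ κ₂ : ℝ) {Φ : ℝ × ℝ → ℝ} (h : ContDiff ℝ (⊤ : ℕ∞) Φ) :
    Continuous (Lop a₁ a₂ α₁ α₂ κ₁ κ₂ Φ) := by
  have hd : Differentiable ℝ Φ := h.differentiable (by simp)
  have c1 := contDiff_dir h (1, 0)
  have c2 := contDiff_dir h (0, 1)
  have c11 := contDiff_dir c1 (1, 0)
  have c22 := contDiff_dir c2 (0, 1)
  have d1 := c1.differentiable (by simp)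
  have d2 := c2.differentiable (by simp)
  have e : Lop a₁ a₂ α₁ α₂ κ₁ κ₂ Φ = fun p =>
      (a₁ * p.1 - α₁ * p.1 ^ 2 + p.2 ^ 2) * fderiv ℝ Φ p (1, 0)
      + (a₂ * p.2 - α₂ * p.1 * p.2) * fderiv ℝ Φ p (0, 1)
      + κ₁ * fderiv ℝ (fun z => fderiv ℝ Φ z (1, 0)) p (1, 0)
      + κ₂ * fderiv ℝ (fun z => fderiv ℝ Φ z (0, 1)) p (0, 1) := by
    funext p
    obtain ⟨x, y⟩ := p
    have ex : deriv (fun t => Φ (t, y)) = fun x => fderiv ℝ Φ (x, y) (1, 0) := by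
      funext x; exact slice_x hd x y
    have ey : deriv (fun t => Φ (x, t)) = fun y => fderiv ℝ Φ (x, y) (0, 1) := by
      funext y; exact slice_y hd x y
    simp only [Lop]
    rw [ex, ey, slice_x d1, slice_y d2]
  rw [e]
  have := c1.continuous
  have := c2.continuous
  have := c11.continuous
  have := c22.continuous
  fun_prop

noncomputable def PhG (g k c : ℝ) (z : ℝ × ℝ) : ℝ :=
  Real.smoothTransition (z.1 ^ 2 + g * z.2 ^ 2 - 1) * Ph g k c z.1 z.2

lemma PhG_smooth {g k : ℝ} (c : ℝ) (hg : 0 < g) (hk : 0 < k) :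
    ContDiff ℝ (⊤ : ℕ∞) (PhG g k c) := by
  rw [contDiff_iff_contDiffAt]
  intro z
  have hN : ContDiff ℝ (⊤ : ℕ∞) (fun z : ℝ × ℝ => z.1 ^ 2 + g * z.2 ^ 2) := by fun_prop
  by_cases h : z.1 ^ 2 + g * z.2 ^ 2 < 1
  · have : PhG g k c =ᶠ[nhds z] fun _ => 0 := by
      filter_upwards [hN.continuous.continuousAt.eventually_lt continuousAt_const h] with w hw
      unfold PhG
      rw [Real.smoothTransition.zero_of_nonpos (by linarith), zero_mul]
    exact contDiffAt_const.congr_of_eventuallyEq this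
  · have h0 : 0 < z.1 ^ 2 + g * z.2 ^ 2 := by linarith
    have hR : ContDiffAt ℝ (⊤ : ℕ∞) (fun z : ℝ × ℝ => Rf g z.1 z.2) z :=
      hN.contDiffAt.sqrt h0.ne'
    have hV : ContDiffAt ℝ (⊤ : ℕ∞) (fun z : ℝ × ℝ => Vf g z.1 z.2 + k) z := by
      unfold Vf
      exact ((hR.pow 3).add (contDiffAt_fst.mul (hR.pow 2))).add contDiffAt_const
    have hv : Vf g z.1 z.2 + k ≠ 0 := by
      linarith [Vf_nonneg (x := z.1) (y := z.2) hg] |> fun h : 0 < Vf g z.1 z.2 + k => h.ne'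
    unfold PhG Ph FF
    refine ContDiffAt.mul ?_ ?_
    · exact Real.smoothTransition.contDiff.contDiffAt.comp z
        (hN.contDiffAt.sub contDiffAt_const)
    · exact (contDiffAt_const.mul (hR.log (Rf_pos h0).ne')).sub
        (contDiffAt_const.mul ((hV.log hv).sub (contDiffAt_const.div hV hv)))

lemma PhG_eq {g k c : ℝ} {x y : ℝ} (h : 2 < x ^ 2 + g * y ^ 2) :
    PhG g k c (x, y) = Ph g k c x y := by
  simp only [PhG]
  rw [Real.smoothTransition.one_of_one_le (by linarith), one_mul]

lemma Lop_PhG (a₁ a₂ α₁ α₂ κ₁ κ₂ : ℝ) {g k : ℝ} (c : ℝ) (hg : 0 < g) (hk : 0 < k) {x y : ℝ}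
    (h : 2 < x ^ 2 + g * y ^ 2) :
    Lop a₁ a₂ α₁ α₂ κ₁ κ₂ (PhG g k c) (x, y) =
      (a₁ * x - α₁ * x ^ 2 + y ^ 2) * Px g k c x y + (a₂ * y - α₂ * x * y) * Py g k c x y
      + κ₁ * Pxx g k c x y + κ₂ * Pyy g k c x y := by
  have ox : ∀ t : ℝ, 2 < t ^ 2 + g * y ^ 2 → ∀ᶠ s in nhds t, 2 < s ^ 2 + g * y ^ 2 := by
    intro t ht
    have : Continuous fun s : ℝ => s ^ 2 + g * y ^ 2 := by fun_prop
    exact continuousAt_const.eventually_lt this.continuousAt ht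
  have oy : ∀ t : ℝ, 2 < x ^ 2 + g * t ^ 2 → ∀ᶠ s in nhds t, 2 < x ^ 2 + g * s ^ 2 := by
    intro t ht
    have : Continuous fun s : ℝ => x ^ 2 + g * s ^ 2 := by fun_prop
    exact continuousAt_const.eventually_lt this.continuousAt ht
  have dx : ∀ t : ℝ, 2 < t ^ 2 + g * y ^ 2 →
      deriv (fun s => PhG g k c (s, y)) t = Px g k c t y := by
    intro t ht
    have e : (fun s => PhG g k c (s, y)) =ᶠ[nhds t] fun s => Ph g k c s y := by
      filter_upwards [ox t ht] with s hs
      exact PhG_eq hs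
    rw [e.deriv_eq]
    exact (hP_x c hg hk (by linarith)).deriv
  have dy : ∀ t : ℝ, 2 < x ^ 2 + g * t ^ 2 →
      deriv (fun s => PhG g k c (x, s)) t = Py g k c x t := by
    intro t ht
    have e : (fun s => PhG g k c (x, s)) =ᶠ[nhds t] fun s => Ph g k c x s := by
      filter_upwards [oy t ht] with s hs
      exact PhG_eq hs
    rw [e.deriv_eq]
    exact (hP_y c hg hk (by linarith)).deriv
  have dxx : deriv (deriv (fun s => PhG g k c (s, y))) x = Pxx g k c x y := by
    have e : deriv (fun s => PhG g k c (s, y)) =ᶠ[nhds x] fun s => Px g k c s y := by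
      filter_upwards [ox x h] with s hs
      exact dx s hs
    rw [e.deriv_eq]
    exact (hP_xx c hg hk (by linarith)).deriv
  have dyy : deriv (deriv (fun s => PhG g k c (x, s))) y = Pyy g k c x y := by
    have e : deriv (fun s => PhG g k c (x, s)) =ᶠ[nhds y] fun s => Py g k c x s := by
      filter_upwards [oy y h] with s hs
      exact dy s hs
    rw [e.deriv_eq]
    exact (hP_yy c hg hk (by linarith)).deriv
  simp only [Lop]
  rw [dx x h, dy y h, dxx, dyy]

lemma Ph_bounds {g k c : ℝ} (hg : 0 < g) (hk : 0 < k) (hc0 : 0 < c) {x y : ℝ}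
    (hR : 1 ≤ Rf g x y) :
    (2 - 2 * c) * Real.log (Rf g x y) - c * Real.log (2 + k) ≤ Ph g k c x y ∧
    Ph g k c x y ≤ (2 + c) * Rf g x y + c * (8 - Real.log k) := by
  have hV := Vf_nonneg (x := x) (y := y) hg
  have hx := (abs_le.1 (abs_le_Rf (x := x) (y := y) hg)).2
  have hV2 : Vf g x y ≤ 2 * Rf g x y ^ 3 := by
    unfold Vf
    nlinarith [mul_le_mul_of_nonneg_right hx (sq_nonneg (Rf g x y))]
  unfold Ph FF
  generalize Vf g x y = v at *
  generalize Rf g x y = R at *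
  have hR0 : 0 < R := by linarith
  have q1 : 0 ≤ 8 * k / (v + k) := by positivity
  have q2 : 8 * k / (v + k) ≤ 8 := by
    rw [div_le_iff₀ (by linarith)]; linarith
  constructor
  · have h1 : Real.log (v + k) ≤ Real.log ((2 + k) * R ^ 3) := by
      apply Real.log_le_log (by linarith)
      nlinarith [one_le_pow₀ hR (n := 3)]
    rw [Real.log_mul (by positivity) (by positivity), Real.log_pow] at h1
    push_cast at h1
    nlinarith [mul_le_mul_of_nonneg_left h1 hc0.le, mul_nonneg hc0.le q1]
  · have h1 : Real.log k ≤ Real.log (v + k) := Real.log_le_log hk (by linarith)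
    have h2 : Real.log R ≤ R := (Real.log_le_sub_one_of_pos hR0).trans (by linarith)
    have h3 := mul_le_mul_of_nonneg_left h2 (by linarith : 0 ≤ 2 + c)
    have h4 := mul_le_mul_of_nonneg_left h1 hc0.le
    have h5 := mul_le_mul_of_nonneg_left q2 hc0.le
    linarith

lemma norm_le_Rf {g : ℝ} (hg : 0 < g) (z : ℝ × ℝ) :
    ‖z‖ ≤ (1 + (Real.sqrt g)⁻¹) * Rf g z.1 z.2 := by
  have hs := Real.sqrt_pos.2 hg
  have h0 : 0 ≤ Rf g z.1 z.2 := Real.sqrt_nonneg _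
  have h1 := abs_le_Rf (x := z.1) (y := z.2) hg
  have h2 : |Real.sqrt g * z.2| ≤ Rf g z.1 z.2 := by
    apply Real.abs_le_sqrt
    rw [mul_pow, Real.sq_sqrt hg.le]
    nlinarith [sq_nonneg z.1]
  rw [abs_mul, abs_of_pos hs] at h2
  have h3 : |z.2| ≤ (Real.sqrt g)⁻¹ * Rf g z.1 z.2 := by
    rw [inv_mul_eq_div, le_div_iff₀ hs]; linarith
  have h4 : 0 ≤ (Real.sqrt g)⁻¹ * Rf g z.1 z.2 := by positivity
  rw [Prod.norm_def, Real.norm_eq_abs, Real.norm_eq_abs]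
  apply max_le <;> nlinarith

lemma main_est (a₁ a₂ α₁ d κ₁ κ₂ c k : ℝ) (hα : 0 < α₁) (hd : 0 < d) (hκ₁ : 0 ≤ κ₁)
    (hκ₂ : 0 < κ₂) (hc0 : 0 < c) (hc1 : c < 1) (hc : α₁ < c * (α₁ + d))
    (hk : κ₂ * d⁻¹ = (2 * (α₁ + d) + α₁) * (k / 3)) (hk0 : 0 < k) :
    ∃ δ > 0, ∃ B : ℝ, ∀ x y : ℝ, 2 < x ^ 2 + d⁻¹ * y ^ 2 →
      Lop a₁ a₂ α₁ (α₁ + d) κ₁ κ₂ (PhG d⁻¹ k c) (x, y) ≤ -δ * Rf d⁻¹ x y + B := by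
  obtain ⟨δ, hδ, B, H⟩ := core_ineq a₁ a₂ α₁ d κ₁ κ₂ c k hα hd hκ₁ hκ₂ hc0 hc1 hc hk hk0
  refine ⟨δ, hδ, B, fun x y h => ?_⟩
  have hg : 0 < d⁻¹ := inv_pos.2 hd
  have hN : 0 < x ^ 2 + d⁻¹ * y ^ 2 := by linarith
  rw [Lop_PhG a₁ a₂ α₁ (α₁ + d) κ₁ κ₂ c hg hk0 h]
  have hR0 := Rf_pos hN
  have hRs := Rf_sq hN
  have hx := abs_le.1 (abs_le_Rf (x := x) (y := y) hg)
  have hR1 : 1 ≤ Rf d⁻¹ x y := by nlinarith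
  unfold Px Py Pxx Pyy Ax Ay
  have hV : Vf d⁻¹ x y = Rf d⁻¹ x y ^ 3 * (1 + x / Rf d⁻¹ x y) := by
    unfold Vf
    generalize Rf d⁻¹ x y = R at hR0 ⊢
    field_simp
  generalize Vf d⁻¹ x y = v at *
  generalize Rf d⁻¹ x y = R at *
  obtain ⟨u, rfl⟩ : ∃ u, x = R * u := ⟨x / R, by field_simp⟩
  have hu : R * u / R = u := by field_simp
  rw [hu] at hV
  have hy : y ^ 2 = d * (R ^ 2 * (1 - u ^ 2)) := by
    have : d * (d⁻¹ * y ^ 2) = y ^ 2 := by field_simp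
    rw [← this]
    congr 1
    linarith
  have h1 : -1 ≤ u := by nlinarith
  have h2 : u ≤ 1 := by nlinarith
  have K := H R u v hR1 h1 h2 hV
  have E := core_eq a₁ a₂ α₁ d κ₁ κ₂ c R u y (F1 k v) (F2 k v) hd hR0 hy
  rw [← hV] at E
  rw [E]
  exact K

/-- if `0 < α₁ < α₂`, `κ₁ ≥ 0`, `κ₂ > 0`, there is a smooth `Φ : ℝ² → ℝ`
tending to `∞` at infinity and satisfying `LΦ ≤ -CΦ + D` everywhere for some `C, D > 0`. -/
theorem statement0 (a₁ a₂ α₁ α₂ κ₁ κ₂ : ℝ) (hα₁ : 0 < α₁) (hα : α₁ < α₂)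
    (hκ₁ : 0 ≤ κ₁) (hκ₂ : 0 < κ₂) :
    ∃ Φ : ℝ × ℝ → ℝ, ContDiff ℝ (⊤ : ℕ∞) Φ ∧
      (∀ M : ℝ, ∃ R : ℝ, ∀ z : ℝ × ℝ, R < ‖z‖ → M < Φ z) ∧
      (∃ C > (0:ℝ), ∃ D > (0:ℝ), ∀ z : ℝ × ℝ,
        Lop a₁ a₂ α₁ α₂ κ₁ κ₂ Φ z ≤ -C * Φ z + D) := by
  obtain ⟨d, rfl⟩ : ∃ d, α₂ = α₁ + d := ⟨α₂ - α₁, by ring⟩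
  have hd : 0 < d := by linarith
  have hg : 0 < d⁻¹ := inv_pos.2 hd
  obtain ⟨c, hcl, hc1⟩ : ∃ c, α₁ / (α₁ + d) < c ∧ c < 1 :=
    exists_between (by rw [div_lt_one (by linarith)]; linarith)
  have hc0 : 0 < c := lt_trans (by positivity) hcl
  rw [div_lt_iff₀ (by linarith)] at hcl
  obtain ⟨k, hk0, hk⟩ : ∃ k, 0 < k ∧ κ₂ * d⁻¹ = (2 * (α₁ + d) + α₁) * (k / 3) :=
    ⟨3 * (κ₂ * d⁻¹) / (2 * (α₁ + d) + α₁), by positivity, by field_simp⟩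
  obtain ⟨δ, hδ, B, H⟩ := main_est a₁ a₂ α₁ d κ₁ κ₂ c k hα₁ hd hκ₁ hκ₂ hc0 hc1 hcl hk hk0
  have hs := PhG_smooth c hg hk0
  have hA : 0 < 1 + (Real.sqrt d⁻¹)⁻¹ := by positivity
  refine ⟨PhG d⁻¹ k c, hs, ?_, ?_⟩
  · intro M
    set r := max 2 (Real.exp ((M + c * Real.log (2 + k)) / (2 - 2 * c))) with hr
    refine ⟨(1 + (Real.sqrt d⁻¹)⁻¹) * r, fun z hz => ?_⟩
    obtain ⟨x, y⟩ := z
    have h1 : r < Rf d⁻¹ x y :=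
      lt_of_mul_lt_mul_left (hz.trans_le (norm_le_Rf hg (x, y))) hA.le
    have h2 : 2 < Rf d⁻¹ x y := (le_max_left _ _).trans_lt h1
    have h3 := (le_max_right _ _).trans_lt h1
    have hN : 2 < x ^ 2 + d⁻¹ * y ^ 2 := by
      have := (Real.lt_sqrt (by norm_num)).1 h2
      linarith
    rw [PhG_eq hN]
    have h4 := (Ph_bounds (x := x) (y := y) hg hk0 hc0 (by linarith)).1
    have h5 := (Real.lt_log_iff_exp_lt (by linarith)).2 h3
    rw [div_lt_iff₀ (by linarith)] at h5
    linarith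
  · set C := δ / (2 + c) with hC
    have hC0 : 0 < C := by positivity
    have hCe : C * (2 + c) = δ := by rw [hC]; field_simp
    have hcont : Continuous fun z => Lop a₁ a₂ α₁ (α₁ + d) κ₁ κ₂ (PhG d⁻¹ k c) z
        + C * PhG d⁻¹ k c z :=
      (Lop_cont _ _ _ _ _ _ hs).add (continuous_const.mul hs.continuous)
    obtain ⟨D₁, hD₁⟩ := (isCompact_closedBall (0 : ℝ × ℝ)
      ((1 + (Real.sqrt d⁻¹)⁻¹) * 2)).bddAbove_image hcont.continuousOn
    refine ⟨C, hC0, |D₁| + |B + C * (c * (8 - Real.log k))| + 1, by positivity, fun z => ?_⟩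
    obtain ⟨x, y⟩ := z
    by_cases hN : 2 < x ^ 2 + d⁻¹ * y ^ 2
    · have h1 := H x y hN
      have hR1 : 1 ≤ Rf d⁻¹ x y := by
        unfold Rf; rw [Real.one_le_sqrt]; linarith
      have h2 := mul_le_mul_of_nonneg_left (Ph_bounds (x := x) (y := y) hg hk0 hc0 hR1).2 hC0.le
      have h3 : C * ((2 + c) * Rf d⁻¹ x y) = δ * Rf d⁻¹ x y := by rw [← mul_assoc, hCe]
      rw [PhG_eq hN]
      have := le_abs_self (B + C * (c * (8 - Real.log k)))
      have := abs_nonneg D₁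
      linarith
    · have hm : (x, y) ∈ Metric.closedBall (0 : ℝ × ℝ) ((1 + (Real.sqrt d⁻¹)⁻¹) * 2) := by
        rw [mem_closedBall_zero_iff]
        refine (norm_le_Rf hg (x, y)).trans (mul_le_mul_of_nonneg_left ?_ hA.le)
        exact Real.sqrt_le_iff.2 ⟨by norm_num, by simp only; linarith⟩
      have h1 := hD₁ (Set.mem_image_of_mem _ hm)
      have := le_abs_self D₁
      have := abs_nonneg (B + C * (c * (8 - Real.log k)))
      linarith
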